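/- There exists a universal constant c > 0 with the following property. Let ξ be a standard Gaussian vector N(0, I_n), let w, v ∈ ℝ^n be unit vectors with ρ = ⟨w,v⟩ > 0, and let t, s ∈ ℝ. Then Cov( sgn(⟨w,ξ⟩ − t), sgn(⟨v,ξ⟩ − s) ) ≥ c · ρ φ(t) φ(s) / ((1 + |t|)(1 + |s|)). -/

import Mathlib

open Finset MeasureTheory ProbabilityTheory

/-- The standard Gaussian measure `N(0, I_n)` on `ℝ^n`. -/
noncomputable def stdGaussian (n : ℕ) : Measure (Fin n → ℝ) :=
  Measure.pi fun _ => gaussianReal 0 1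

/-- Covariance of two functions under the standard Gaussian measure. -/
noncomputable def gaussCov (n : ℕ) (f g : (Fin n → ℝ) → ℝ) : ℝ :=
  (∫ x, f x * g x ∂stdGaussian n) -
    (∫ x, f x ∂stdGaussian n) * (∫ x, g x ∂stdGaussian n)

/-- The sign function: `+1` if `x > 0` and `-1` if `x ≤ 0`. -/
noncomputable def sgn (x : ℝ) : ℝ := if 0 < x then 1 else -1

/-- The standard normal density `φ(t) = e^{-t²/2}/√(2π)`. -/
noncomputable def stdNormalPDF (t : ℝ) : ℝ :=
  Real.exp (-t ^ 2 / 2) / Real.sqrt (2 * Real.pi)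

lemma cov_coord (n : ℕ) (w u : Fin n → ℝ) :
    cov[fun x : Fin n → ℝ => ∑ i, w i * x i, fun x => ∑ i, u i * x i;
      Measure.pi fun _ => gaussianReal 0 1] = ∑ i, w i * u i := by
  have hlp : ∀ i : Fin n, MemLp (fun x : Fin n → ℝ => x i) 2
      (Measure.pi fun _ => gaussianReal 0 1) := by
    intro i
    have h := (memLp_id_gaussianReal (μ := 0) (v := 1) 2)
    exact h.comp_measurePreserving (measurePreserving_eval (fun _ : Fin n => gaussianReal 0 1) i)
  have hI := iIndepFun_pi (μ := fun _ : Fin n => gaussianReal 0 1) (X := fun _ => (id : ℝ → ℝ))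
    (fun i => by fun_prop)
  rw [covariance_fun_sum_fun_sum (fun i => (hlp i).const_mul _) (fun i => (hlp i).const_mul _)]
  refine Finset.sum_congr rfl fun i _ => ?_
  rw [Finset.sum_eq_single i]
  · rw [covariance_const_mul_left, covariance_const_mul_right, covariance_self (Measurable.aemeasurable (by fun_prop))]
    have : Var[fun x : Fin n → ℝ => x i; Measure.pi fun _ => gaussianReal 0 1] = 1 := by
      have h := (measurePreserving_eval (fun _ : Fin n => gaussianReal 0 1) i).variance_fun_comp
        (f := id) (by fun_prop)
      simpa using h
    rw [this]; ring
  · intro j _ hj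
    rw [covariance_const_mul_left, covariance_const_mul_right]
    have := (hI.indepFun hj.symm).covariance_eq_zero (hlp i) (hlp j)
    simp only [id] at this
    rw [this]; ring
  · simp

lemma mean_coord (n : ℕ) (w : Fin n → ℝ) :
    ∫ x : Fin n → ℝ, ∑ i, w i * x i ∂(Measure.pi fun _ => gaussianReal 0 1) = 0 := by
  rw [integral_finsetSum]
  · refine Finset.sum_eq_zero fun i _ => ?_
    rw [integral_const_mul]
    have h := integral_comp_eval (μ := fun _ : Fin n => gaussianReal 0 1) (i := i)
      (f := fun x : ℝ => x) (by fun_prop)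
    rw [h, integral_id_gaussianReal]; ring
  · intro i _
    refine Integrable.const_mul ?_ _
    have h := (memLp_id_gaussianReal (μ := 0) (v := 1) 1)
    exact memLp_one_iff_integrable.1
      (h.comp_measurePreserving (measurePreserving_eval (fun _ : Fin n => gaussianReal 0 1) i))

noncomputable def linF (n : ℕ) (w : Fin n → ℝ) : (Fin n → ℝ) →L[ℝ] ℝ :=
  ∑ i, w i • ContinuousLinearMap.proj (R := ℝ) (φ := fun _ : Fin n => ℝ) i

lemma linF_apply (n : ℕ) (w x : Fin n → ℝ) : linF n w x = ∑ i, w i * x i := by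
  simp [linF]

lemma gauss_pair (n : ℕ) (w u : Fin n → ℝ) :
    HasGaussianLaw (fun x : Fin n → ℝ => (∑ i, w i * x i, ∑ i, u i * x i))
      (Measure.pi fun _ => gaussianReal 0 1) := by
  have hI := iIndepFun_pi (μ := fun _ : Fin n => gaussianReal 0 1) (X := fun _ => (id : ℝ → ℝ))
    (fun i => by fun_prop)
  have h1 := hI.hasGaussianLaw (fun i => by
    refine HasLaw.hasGaussianLaw (μ := gaussianReal 0 1) ?_
    exact ⟨Measurable.aemeasurable (by fun_prop), (measurePreserving_eval (fun _ : Fin n => gaussianReal 0 1) i).map_eq⟩)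
  have := h1.map_fun ((linF n w).prod (linF n u))
  simpa [linF_apply] using this

lemma law_one (n : ℕ) (w : Fin n → ℝ) (hw : ∑ i, w i ^ 2 = 1) :
    (Measure.pi fun _ => gaussianReal 0 1).map (fun x : Fin n → ℝ => ∑ i, w i * x i)
      = gaussianReal 0 1 := by
  rw [(gauss_pair n w w).fst.map_eq_gaussianReal, mean_coord, ← covariance_self (Measurable.aemeasurable (by fun_prop)),
    cov_coord]
  simp [← pow_two, hw]

lemma law_two (n : ℕ) (w u : Fin n → ℝ) (hw : ∑ i, w i ^ 2 = 1) (hu : ∑ i, u i ^ 2 = 1)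
    (hwu : ∑ i, w i * u i = 0) :
    (Measure.pi fun _ => gaussianReal 0 1).map
      (fun x : Fin n → ℝ => (∑ i, w i * x i, ∑ i, u i * x i))
      = (gaussianReal 0 1).prod (gaussianReal 0 1) := by
  have h := (gauss_pair n w u).indepFun_of_covariance_eq_zero (by rw [cov_coord, hwu])
  rw [(indepFun_iff_map_prod_eq_prod_map_map (Measurable.aemeasurable (by fun_prop))
    (Measurable.aemeasurable (by fun_prop))).1 h,
    law_one n w hw, law_one n u hu]

lemma sgn_cov {Ω : Type*} [MeasurableSpace Ω] (P : Measure Ω) [IsProbabilityMeasure P]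
    (X Y : Ω → ℝ) (hX : Measurable X) (hY : Measurable Y) (t s : ℝ) :
    (∫ x, sgn (X x - t) * sgn (Y x - s) ∂P) - (∫ x, sgn (X x - t) ∂P) * (∫ x, sgn (Y x - s) ∂P)
      = 4 * (P.real {x | t < X x ∧ s < Y x} - P.real {x | t < X x} * P.real {x | s < Y x}) := by
  have hA : MeasurableSet {x | t < X x} := measurableSet_lt measurable_const hX
  have hB : MeasurableSet {x | s < Y x} := measurableSet_lt measurable_const hY
  have hAB : MeasurableSet {x | t < X x ∧ s < Y x} := hA.inter hB
  have e : ∀ (Z : Ω → ℝ) (a : ℝ), (fun x => sgn (Z x - a)) =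
      fun x => 2 * ({x | a < Z x}.indicator 1 x) - 1 := by
    intro Z a; ext x
    by_cases h : a < Z x <;> simp [sgn, h]; norm_num
  have e2 : (fun x => sgn (X x - t) * sgn (Y x - s)) =
      fun x => 4 * ({x | t < X x ∧ s < Y x}.indicator 1 x)
        - 2 * ({x | t < X x}.indicator 1 x) - 2 * ({x | s < Y x}.indicator 1 x) + 1 := by
    ext x
    by_cases h : t < X x <;> by_cases h' : s < Y x <;> simp [sgn, h, h'] <;> norm_num
  have i1 : ∀ {A : Set Ω}, MeasurableSet A → Integrable (A.indicator (1 : Ω → ℝ)) P :=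
    fun hA => (integrable_const (1 : ℝ)).indicator hA
  have j1 := (i1 hA).const_mul 2
  have j2 := (i1 hB).const_mul 2
  have j3 := (i1 hAB).const_mul 4
  rw [e2, e, e, integral_add (by exact (j3.sub j1).sub j2) (integrable_const _),
    integral_sub (by exact j3.sub j1) j2, integral_sub j3 j1,
    integral_sub j1 (integrable_const _), integral_sub j2 (integrable_const _)]
  simp only [integral_const_mul, integral_indicator_one hA, integral_indicator_one hB,
    integral_indicator_one hAB]
  simp
  ring

lemma pdf_eq (x : ℝ) : gaussianPDFReal 0 1 x = stdNormalPDF x := by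
  simp [gaussianPDFReal, stdNormalPDF]; ring

lemma pdf_eq' : gaussianPDFReal 0 1 = stdNormalPDF := funext pdf_eq

lemma pdf_pos (x : ℝ) : 0 < stdNormalPDF x := by unfold stdNormalPDF; positivity

lemma pdf_cont : Continuous stdNormalPDF := by unfold stdNormalPDF; fun_prop

lemma pdf_le_one (x : ℝ) : stdNormalPDF x ≤ 1 := by
  unfold stdNormalPDF
  have h1 : Real.exp (-x ^ 2 / 2) ≤ 1 := Real.exp_le_one_iff.2 (by nlinarith [sq_nonneg x])
  have h2 : 1 ≤ Real.sqrt (2 * Real.pi) := by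
    rw [Real.one_le_sqrt]; nlinarith [Real.pi_gt_three]
  rw [div_le_one (by positivity)]; linarith

lemma pdf_int : Integrable stdNormalPDF := pdf_eq' ▸ integrable_gaussianPDFReal 0 1

lemma pdf_deriv (x : ℝ) : HasDerivAt stdNormalPDF (-x * stdNormalPDF x) x := by
  unfold stdNormalPDF
  have h : HasDerivAt (fun x : ℝ => -x ^ 2 / 2) (-x) x := by
    have := ((hasDerivAt_pow 2 x).neg).div_const 2
    exact HasDerivAt.congr_deriv this (by simp; ring)
  exact HasDerivAt.congr_deriv ((h.exp).div_const (Real.sqrt (2 * Real.pi))) (by ring)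

lemma pdf_abs_int : Integrable (fun x => |x| * stdNormalPDF x) := by
  have h := (integrable_mul_exp_neg_mul_sq (b := 1/2) (by norm_num)).abs.div_const
    (Real.sqrt (2 * Real.pi))
  refine h.congr (Filter.Eventually.of_forall fun x => ?_)
  simp only [abs_mul, Real.abs_exp, stdNormalPDF]
  rw [mul_div_assoc]
  congr 3
  ring

lemma pdf_tendsto : Filter.Tendsto stdNormalPDF Filter.atTop (nhds 0) := by
  unfold stdNormalPDF
  rw [show (0:ℝ) = 0 / Real.sqrt (2 * Real.pi) by simp]
  refine Filter.Tendsto.div_const ?_ _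
  refine Real.tendsto_exp_atBot.comp ?_
  have : (fun x : ℝ => -x ^ 2 / 2) = fun x => -(x ^ 2 / 2) := by ext; ring
  rw [this]
  exact Filter.tendsto_neg_atTop_atBot.comp
    ((Filter.tendsto_pow_atTop (by norm_num)).atTop_div_const (by norm_num))

noncomputable def tailQ (a : ℝ) : ℝ := ∫ x in Set.Ioi a, stdNormalPDF x

lemma tailQ_eq (a : ℝ) : tailQ a = (gaussianReal 0 1).real (Set.Ioi a) := by
  rw [Measure.real, gaussianReal_apply_eq_integral _ one_ne_zero, pdf_eq', tailQ,
    ENNReal.toReal_ofReal]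
  exact integral_nonneg fun x => (pdf_pos x).le

lemma tailQ_nonneg (a : ℝ) : 0 ≤ tailQ a := by rw [tailQ_eq]; positivity
lemma tailQ_le (a : ℝ) : tailQ a ≤ 1 := by rw [tailQ_eq]; exact measureReal_le_one

lemma tailQ_deriv (a : ℝ) : HasDerivAt tailQ (-stdNormalPDF a) a := by
  have h : tailQ = fun a => tailQ 0 - ∫ x in (0:ℝ)..a, stdNormalPDF x := by
    ext b
    rw [← intervalIntegral.integral_Ioi_sub_Ioi' pdf_int.integrableOn pdf_int.integrableOn]
    simp [tailQ]
  rw [h]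
  have := (intervalIntegral.integral_hasDerivAt_right (pdf_cont.intervalIntegrable 0 a)
    pdf_cont.stronglyMeasurable.stronglyMeasurableAtFilter pdf_cont.continuousAt)
  exact this.const_sub _

lemma tailQ_cont : Continuous tailQ :=
  continuous_iff_continuousAt.2 fun a => (tailQ_deriv a).continuousAt

lemma tailQ_neg (a : ℝ) : tailQ (-a) = 1 - tailQ a := by
  have h1 := integral_gaussianPDFReal_eq_one 0 (v := 1) one_ne_zero
  rw [pdf_eq', ← intervalIntegral.integral_Iic_add_Ioi (b := a) pdf_int.integrableOn
    pdf_int.integrableOn] at h1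
  have h2 : tailQ (-a) = ∫ x in Set.Iic a, stdNormalPDF x := by
    have := integral_comp_neg_Iic a stdNormalPDF
    rw [tailQ, ← this]
    simp [stdNormalPDF]
  rw [h2, tailQ]; linarith

lemma pdf_compare (x y : ℝ) (h : x ^ 2 ≤ y ^ 2 + 2) :
    Real.exp (-1) * stdNormalPDF y ≤ stdNormalPDF x := by
  unfold stdNormalPDF
  rw [← mul_div_assoc, ← Real.exp_add]
  gcongr
  linarith

lemma tailQ_lower (s : ℝ) : Real.exp (-1) * stdNormalPDF s / (1 + |s|) ≤ tailQ s := by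
  set d := 1 / (1 + |s|) with hd
  have hd0 : 0 < d := by positivity
  have hd1 : d * (1 + |s|) = 1 := by rw [hd]; field_simp
  have h1 : tailQ s = (∫ x in s..(s+d), stdNormalPDF x) + tailQ (s+d) := by
    rw [← intervalIntegral.integral_Ioi_sub_Ioi' pdf_int.integrableOn pdf_int.integrableOn]
    simp [tailQ]
  have h2 : (∫ _ in s..(s+d), Real.exp (-1) * stdNormalPDF s) ≤
      ∫ x in s..(s+d), stdNormalPDF x := by
    refine intervalIntegral.integral_mono_on (by linarith) (by simp)
      (pdf_cont.intervalIntegrable _ _) fun x hx => pdf_compare _ _ ?_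
    have hx1 := hx.1
    have hx2 := hx.2
    obtain ⟨e, rfl⟩ : ∃ e, x = s + e := ⟨x - s, by ring⟩
    have he0 : 0 ≤ e := by linarith
    have he : e ≤ d := by linarith
    have : e * (1 + |s|) ≤ 1 := by nlinarith [abs_nonneg s]
    have h3 : e ≤ 1 := by nlinarith [abs_nonneg s]
    nlinarith [le_abs_self s, abs_nonneg s]
  rw [intervalIntegral.integral_const] at h2
  have := tailQ_nonneg (s + d)
  rw [h1]
  have e : Real.exp (-1) * stdNormalPDF s / (1 + |s|) =
    (s + d - s) • (Real.exp (-1) * stdNormalPDF s) := by rw [hd, smul_eq_mul]; ring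
  rw [e]; linarith

noncomputable def jointG (t s r : ℝ) : ℝ :=
  ∫ x in Set.Ioi t, stdNormalPDF x * tailQ ((s - r * x) / Real.sqrt (1 - r ^ 2))

lemma arg_deriv (s x r : ℝ) (hr : 0 < 1 - r ^ 2) :
    HasDerivAt (fun r => (s - r * x) / Real.sqrt (1 - r ^ 2))
      (-((x - r * s) / Real.sqrt (1 - r ^ 2) ^ 3)) r := by
  have h1 : HasDerivAt (fun r : ℝ => s - r * x) (-x) r := by
    have := ((hasDerivAt_id r).mul_const x).const_sub s
    exact HasDerivAt.congr_deriv this (by simp)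
  have h2 : HasDerivAt (fun r : ℝ => 1 - r ^ 2) (-(2 * r)) r := by
    have := (hasDerivAt_pow 2 r).const_sub 1
    exact HasDerivAt.congr_deriv this (by simp)
  have h3 := h2.sqrt hr.ne'
  have hp : 0 < Real.sqrt (1 - r ^ 2) := Real.sqrt_pos.2 hr
  refine HasDerivAt.congr_deriv (h1.div h3 hp.ne') ?_
  have hs : Real.sqrt (1 - r ^ 2) ^ 2 = 1 - r ^ 2 := Real.sq_sqrt hr.le
  set q := Real.sqrt (1 - r ^ 2)
  field_simp
  rw [hs]
  ring

lemma kernel_deriv (s r x : ℝ) (hr : 0 < 1 - r ^ 2) :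
    HasDerivAt (fun x => -(stdNormalPDF x * stdNormalPDF ((s - r * x) / Real.sqrt (1 - r ^ 2))
        / Real.sqrt (1 - r ^ 2)))
      (stdNormalPDF x * (stdNormalPDF ((s - r * x) / Real.sqrt (1 - r ^ 2))
        * ((x - r * s) / Real.sqrt (1 - r ^ 2) ^ 3))) x := by
  have h1 : HasDerivAt (fun x : ℝ => (s - r * x) / Real.sqrt (1 - r ^ 2))
      (-r / Real.sqrt (1 - r ^ 2)) x := by
    have := (((hasDerivAt_id x).const_mul r).const_sub s).div_const (Real.sqrt (1 - r ^ 2))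
    exact HasDerivAt.congr_deriv this (by simp)
  have h2 := (pdf_deriv ((s - r * x) / Real.sqrt (1 - r ^ 2))).comp x h1
  have h3 := (((pdf_deriv x).mul h2).div_const (Real.sqrt (1 - r ^ 2))).neg
  refine HasDerivAt.congr_deriv h3 ?_
  have hp : 0 < Real.sqrt (1 - r ^ 2) := Real.sqrt_pos.2 hr
  have hs : Real.sqrt (1 - r ^ 2) ^ 2 = 1 - r ^ 2 := Real.sq_sqrt hr.le
  simp only [Function.comp]
  set q := Real.sqrt (1 - r ^ 2)
  set A := stdNormalPDF x
  set B := stdNormalPDF ((s - r * x) / q)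
  have hr2 : r ^ 2 = 1 - q ^ 2 := by linarith
  field_simp
  ring_nf
  rw [hr2]
  ring

lemma jointG_deriv (t s r : ℝ) (hr : |r| < 1) :
    HasDerivAt (jointG t s) (stdNormalPDF t * stdNormalPDF ((s - r * t) / Real.sqrt (1 - r ^ 2))
        / Real.sqrt (1 - r ^ 2)) r := by
  obtain ⟨R, hR1, hR2⟩ := exists_between hr
  have hR0 : 0 ≤ R := (abs_nonneg r).trans hR1.le
  have hRR : 0 < 1 - R ^ 2 := by nlinarith
  have key : ∀ y ∈ Set.Ioo (-R) R, 1 - R ^ 2 ≤ 1 - y ^ 2 := by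
    intro y hy
    have := sq_le_sq' hy.1.le hy.2.le
    linarith
  have hrmem : r ∈ Set.Ioo (-R) R := abs_lt.1 hR1
  have hr' : 0 < 1 - r ^ 2 := hRR.trans_le (key r hrmem)
  have hm : ∀ y : ℝ, Continuous fun x => (s - y * x) / Real.sqrt (1 - y ^ 2) := by
    intro y; fun_prop
  have main := hasDerivAt_integral_of_dominated_loc_of_deriv_le
    (μ := volume.restrict (Set.Ioi t)) (x₀ := r) (s := Set.Ioo (-R) R)
    (F := fun y x => stdNormalPDF x * tailQ ((s - y * x) / Real.sqrt (1 - y ^ 2)))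
    (F' := fun y x => (stdNormalPDF x * (stdNormalPDF ((s - y * x) / Real.sqrt (1 - y ^ 2))
        * ((x - y * s) / Real.sqrt (1 - y ^ 2) ^ 3))))
    (bound := fun x => (|x| * stdNormalPDF x + |s| * stdNormalPDF x) / Real.sqrt (1 - R ^ 2) ^ 3)
    (Ioo_mem_nhds hrmem.1 hrmem.2)
    (Filter.Eventually.of_forall fun y =>
      (pdf_cont.mul (tailQ_cont.comp (hm y))).aestronglyMeasurable)
    ?_ ?_ ?_ ?_ ?_
  · have hval := integral_Ioi_of_hasDerivAt_of_tendsto' (a := t) (m := 0)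
      (fun x _ => kernel_deriv s r x hr') main.1 ?_
    · refine HasDerivAt.congr_deriv main.2 ?_
      rw [hval]; ring
    · have h0 : Filter.Tendsto (fun x => stdNormalPDF x *
          stdNormalPDF ((s - r * x) / Real.sqrt (1 - r ^ 2))) Filter.atTop (nhds 0) := by
        refine squeeze_zero (fun x => (mul_pos (pdf_pos _) (pdf_pos _)).le) (fun x => ?_) pdf_tendsto
        exact mul_le_of_le_one_right (pdf_pos _).le (pdf_le_one _)
      simpa using (h0.div_const (Real.sqrt (1 - r ^ 2))).neg
  · refine Integrable.mono (pdf_int.integrableOn (s := Set.Ioi t))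
      (pdf_cont.mul (tailQ_cont.comp (hm r))).aestronglyMeasurable
      (Filter.Eventually.of_forall fun x => ?_)
    rw [norm_mul, Real.norm_of_nonneg (tailQ_nonneg _)]
    exact mul_le_of_le_one_right (norm_nonneg _) (tailQ_le _)
  · refine (pdf_cont.mul ((pdf_cont.comp (hm r)).mul ?_)).aestronglyMeasurable
    fun_prop
  · refine Filter.Eventually.of_forall fun x y hy => ?_
    have hy' := key y hy
    have hq : 0 < Real.sqrt (1 - R ^ 2) := Real.sqrt_pos.2 hRR
    have hq' : Real.sqrt (1 - R ^ 2) ≤ Real.sqrt (1 - y ^ 2) := Real.sqrt_le_sqrt hy'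
    have hq2 : 0 < Real.sqrt (1 - y ^ 2) := hq.trans_le hq'
    have hy1 : |y| ≤ 1 := (abs_lt.2 hy).le.trans hR2.le
    have hnum : |x - y * s| ≤ |x| + |s| := by
      refine (abs_sub _ _).trans ?_
      rw [abs_mul]
      nlinarith [abs_nonneg s]
    rw [norm_mul, norm_mul, norm_div, Real.norm_of_nonneg (pdf_pos _).le,
      Real.norm_of_nonneg (pdf_pos _).le, Real.norm_eq_abs, Real.norm_of_nonneg (by positivity)]
    have h5 : |x - y * s| / Real.sqrt (1 - y ^ 2) ^ 3 ≤ (|x| + |s|) / Real.sqrt (1 - R ^ 2) ^ 3 := by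
      gcongr
    have h6 : stdNormalPDF ((s - y * x) / Real.sqrt (1 - y ^ 2)) *
        (|x - y * s| / Real.sqrt (1 - y ^ 2) ^ 3) ≤ (|x| + |s|) / Real.sqrt (1 - R ^ 2) ^ 3 :=
      (mul_le_of_le_one_left (by positivity) (pdf_le_one _)).trans h5
    refine (mul_le_mul_of_nonneg_left h6 (pdf_pos x).le).trans (le_of_eq ?_)
    ring
  · exact ((pdf_abs_int.add (pdf_int.const_mul _)).div_const _).integrableOn
  · refine Filter.Eventually.of_forall fun x y hy => ?_
    have h1 := (tailQ_deriv _).comp y (arg_deriv s x y (hRR.trans_le (key y hy)))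
    refine HasDerivAt.congr_deriv (h1.const_mul (stdNormalPDF x)) ?_
    ring

lemma jointG_zero (t s : ℝ) : jointG t s 0 = tailQ t * tailQ s := by
  simp [jointG, integral_mul_const]
  left; rfl

lemma jointG_gap (t s ρ : ℝ) (h0 : 0 < ρ) (h1 : ρ < 1) :
    Real.exp (-1) * (stdNormalPDF t * stdNormalPDF s) * (ρ / (2 * ((1 + |t|) * (1 + |s|))))
      ≤ jointG t s ρ - tailQ t * tailQ s := by
  rw [← jointG_zero]
  set T := (1 + |t|) * (1 + |s|) with hT
  have hT1 : 1 ≤ T := by nlinarith [abs_nonneg t, abs_nonneg s, mul_nonneg (abs_nonneg t) (abs_nonneg s)]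
  set δ := ρ / (2 * T) with hδ
  have hδ0 : 0 < δ := by positivity
  have hδT : δ * (2 * T) = ρ := by rw [hδ]; field_simp
  have hδρ : δ ≤ ρ := by nlinarith
  have hd : ∀ y ∈ Set.Icc (0:ℝ) ρ, HasDerivAt (jointG t s) _ y := fun y hy =>
    jointG_deriv t s y (by rw [abs_of_nonneg hy.1]; linarith [hy.2])
  have step1 : jointG t s δ ≤ jointG t s ρ := by
    have hmono := monotoneOn_of_deriv_nonneg (convex_Icc (0:ℝ) ρ)
      (f := jointG t s) (fun y hy => (hd y hy).continuousAt.continuousWithinAt)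
      (fun y hy => (hd y (interior_subset hy)).differentiableAt.differentiableWithinAt)
      (fun y hy => by
        rw [(hd y (interior_subset hy)).deriv]
        have := pdf_pos t
        have := pdf_pos ((s - y * t) / Real.sqrt (1 - y ^ 2))
        positivity)
    exact hmono ⟨hδ0.le, hδρ⟩ ⟨h0.le, le_rfl⟩ hδρ
  have step2 := (convex_Icc (0:ℝ) δ).mul_sub_le_image_sub_of_le_deriv (f := jointG t s)
      (C := Real.exp (-1) * (stdNormalPDF t * stdNormalPDF s))
      (fun y hy => (hd y ⟨hy.1, hy.2.trans hδρ⟩).continuousAt.continuousWithinAt)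
      (fun y hy => by
        have hy := interior_subset hy
        exact (hd y ⟨hy.1, hy.2.trans hδρ⟩).differentiableAt.differentiableWithinAt)
      (fun y hy => by
        have hy := interior_subset hy
        rw [(hd y ⟨hy.1, hy.2.trans hδρ⟩).deriv]
        have hy0 := hy.1
        have hyT : y * T ≤ 1 / 2 := by nlinarith [hy.2]
        have a1 := abs_nonneg t
        have a2 := abs_nonneg s
        have a3 := mul_nonneg a1 a2
        have b1 : y ≤ 1 / 2 := by nlinarith
        have b2 : y * |t| ≤ 1 / 2 := by nlinarith [mul_nonneg hy0 a3, mul_nonneg hy0 a2]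
        have b3 : y * |s| ≤ 1 / 2 := by nlinarith [mul_nonneg hy0 a3, mul_nonneg hy0 a1]
        have b4 : y * (|t| * |s|) ≤ 1 / 2 := by nlinarith [mul_nonneg hy0 a2, mul_nonneg hy0 a1]
        have c1 : y ^ 2 ≤ 1 / 4 := by nlinarith
        have c2 : (y * t) ^ 2 ≤ 1 / 4 := by
          rw [mul_pow, ← sq_abs t, ← mul_pow]; nlinarith [mul_nonneg hy0 a1]
        have c3 : (y * s) ^ 2 ≤ 1 / 4 := by
          rw [mul_pow, ← sq_abs s, ← mul_pow]; nlinarith [mul_nonneg hy0 a2]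
        have c4 : -(y * (t * s)) ≤ 1 / 2 := by
          have := neg_abs_le (t * s)
          rw [abs_mul] at this
          nlinarith
        have hpos : 0 < 1 - y ^ 2 := by linarith
        have hq : 0 < Real.sqrt (1 - y ^ 2) := Real.sqrt_pos.2 hpos
        have hq1 : Real.sqrt (1 - y ^ 2) ≤ 1 := Real.sqrt_le_one.2 (by nlinarith)
        have hcmp := pdf_compare ((s - y * t) / Real.sqrt (1 - y ^ 2)) s (by
          rw [div_pow, Real.sq_sqrt hpos.le, div_le_iff₀ hpos]
          nlinarith)
        rw [le_div_iff₀ hq]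
        have p1 := pdf_pos t
        have p2 := pdf_pos s
        have p3 := Real.exp_pos (-1)
        calc _ ≤ Real.exp (-1) * (stdNormalPDF t * stdNormalPDF s) :=
              mul_le_of_le_one_right (by positivity) hq1
          _ = stdNormalPDF t * (Real.exp (-1) * stdNormalPDF s) := by ring
          _ ≤ _ := mul_le_mul_of_nonneg_left hcmp p1.le)
      0 ⟨le_rfl, hδ0.le⟩ δ ⟨hδ0.le, le_rfl⟩ hδ0.le
  rw [sub_zero] at step2
  linarith

lemma prod_real (t s ρ : ℝ) (hρ : 0 < 1 - ρ ^ 2) :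
    ((gaussianReal 0 1).prod (gaussianReal 0 1)).real
      {p : ℝ × ℝ | t < p.1 ∧ s < ρ * p.1 + Real.sqrt (1 - ρ ^ 2) * p.2} = jointG t s ρ := by
  have hq : 0 < Real.sqrt (1 - ρ ^ 2) := Real.sqrt_pos.2 hρ
  have hS : MeasurableSet {p : ℝ × ℝ | t < p.1 ∧ s < ρ * p.1 + Real.sqrt (1 - ρ ^ 2) * p.2} := by
    have m1 : MeasurableSet {p : ℝ × ℝ | t < p.1} := measurableSet_lt (by fun_prop) (by fun_prop)
    have m2 : MeasurableSet {p : ℝ × ℝ | s < ρ * p.1 + Real.sqrt (1 - ρ ^ 2) * p.2} :=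
      measurableSet_lt (by fun_prop) (by fun_prop)
    exact m1.inter m2
  have hsec : ∀ x : ℝ, (gaussianReal 0 1 (Prod.mk x ⁻¹'
      {p : ℝ × ℝ | t < p.1 ∧ s < ρ * p.1 + Real.sqrt (1 - ρ ^ 2) * p.2})).toReal
      = (Set.Ioi t).indicator (fun x => tailQ ((s - ρ * x) / Real.sqrt (1 - ρ ^ 2))) x := by
    intro x
    by_cases hx : t < x
    · rw [Set.indicator_of_mem (by exact hx), tailQ_eq, Measure.real]
      congr 2
      ext z
      simp only [Set.mem_preimage, Set.mem_ofPred_eq, Set.mem_Ioi, hx, true_and]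
      rw [div_lt_iff₀ hq]
      constructor <;> intro h <;> linarith
    · rw [Set.indicator_of_notMem (by exact hx)]
      simp [hx]
  rw [Measure.real, Measure.prod_apply hS, ← integral_toReal
    (measurable_measure_prodMk_left hS).aemeasurable
    (Filter.Eventually.of_forall fun x => measure_lt_top _ _)]
  simp_rw [hsec]
  rw [integral_gaussianReal_eq_integral_smul one_ne_zero, pdf_eq', jointG,
    ← integral_indicator measurableSet_Ioi]
  congr 1
  ext x
  by_cases hx : x ∈ Set.Ioi t <;> simp [hx]

lemma one_real (n : ℕ) (w : Fin n → ℝ) (hw : ∑ i, w i ^ 2 = 1) (t : ℝ) :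
    (Measure.pi fun _ => gaussianReal 0 1).real {x : Fin n → ℝ | t < ∑ i, w i * x i} = tailQ t := by
  have h := Measure.map_apply (μ := Measure.pi fun _ : Fin n => gaussianReal 0 1)
    (f := fun x : Fin n → ℝ => ∑ i, w i * x i) (by fun_prop) (measurableSet_Ioi (a := t))
  rw [law_one n w hw] at h
  rw [tailQ_eq, Measure.real, Measure.real, h]
  rfl

lemma two_real (n : ℕ) (w v : Fin n → ℝ) (hw : ∑ i, w i ^ 2 = 1) (hv : ∑ i, v i ^ 2 = 1)
    (hρ : 0 < 1 - (∑ i, w i * v i) ^ 2) (t s : ℝ) :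
    (Measure.pi fun _ => gaussianReal 0 1).real
      {x : Fin n → ℝ | t < ∑ i, w i * x i ∧ s < ∑ i, v i * x i}
      = jointG t s (∑ i, w i * v i) := by
  set ρ := ∑ i, w i * v i with hρd
  set q := Real.sqrt (1 - ρ ^ 2) with hqd
  have hq : 0 < q := Real.sqrt_pos.2 hρ
  have hq2 : q ^ 2 = 1 - ρ ^ 2 := Real.sq_sqrt hρ.le
  set u : Fin n → ℝ := fun i => (v i - ρ * w i) / q with hu
  have e1 : ∑ i, u i ^ 2 = 1 := by
    have : ∑ i, u i ^ 2 = (∑ i, v i ^ 2 - 2 * ρ * ∑ i, w i * v i + ρ ^ 2 * ∑ i, w i ^ 2) / q ^ 2 := by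
      rw [Finset.mul_sum Finset.univ _ (2 * ρ), Finset.mul_sum Finset.univ _ (ρ ^ 2),
        ← Finset.sum_sub_distrib, ← Finset.sum_add_distrib, Finset.sum_div]
      refine Finset.sum_congr rfl fun i _ => ?_
      rw [hu, div_pow]; ring
    rw [this, hw, hv, ← hρd, hq2, div_eq_one_iff_eq hρ.ne']; ring
  have e2 : ∑ i, w i * u i = 0 := by
    have : ∑ i, w i * u i = (∑ i, w i * v i - ρ * ∑ i, w i ^ 2) / q := by
      rw [Finset.mul_sum, ← Finset.sum_sub_distrib, Finset.sum_div]
      refine Finset.sum_congr rfl fun i _ => ?_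
      rw [hu]; ring
    rw [this, hw, ← hρd]; simp
  have e3 : ∀ x : Fin n → ℝ, ∑ i, v i * x i = ρ * ∑ i, w i * x i + q * ∑ i, u i * x i := by
    intro x
    rw [Finset.mul_sum, Finset.mul_sum, ← Finset.sum_add_distrib]
    refine Finset.sum_congr rfl fun i _ => ?_
    simp only [hu]
    field_simp
    ring
  have hS : MeasurableSet {p : ℝ × ℝ | t < p.1 ∧ s < ρ * p.1 + q * p.2} := by
    have m1 : MeasurableSet {p : ℝ × ℝ | t < p.1} := measurableSet_lt (by fun_prop) (by fun_prop)
    have m2 : MeasurableSet {p : ℝ × ℝ | s < ρ * p.1 + q * p.2} :=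
      measurableSet_lt (by fun_prop) (by fun_prop)
    exact m1.inter m2
  rw [← prod_real t s ρ hρ, ← law_two n w u hw e1 e2, Measure.real, Measure.real,
    Measure.map_apply (by fun_prop) hS]
  simp_rw [e3]
  rfl

theorem stmt7 :
    ∃ c : ℝ, 0 < c ∧ ∀ (n : ℕ) (w v : Fin n → ℝ),
      (∑ i, w i ^ 2) = 1 → (∑ i, v i ^ 2) = 1 → 0 < ∑ i, w i * v i →
      ∀ t s : ℝ,
        gaussCov n (fun x => sgn ((∑ i, w i * x i) - t))
            (fun x => sgn ((∑ i, v i * x i) - s)) ≥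
          c * (∑ i, w i * v i) * stdNormalPDF t * stdNormalPDF s /
            ((1 + |t|) * (1 + |s|)) := by
  refine ⟨Real.exp (-1) * Real.exp (-1), by positivity, ?_⟩
  intro n w v hw hv hρ t s
  have hE : Real.exp (-1) ≤ 1 := Real.exp_le_one_iff.2 (by norm_num)
  have hE0 := Real.exp_pos (-1)
  have hcov := sgn_cov (Measure.pi fun _ : Fin n => gaussianReal 0 1)
    (fun x => ∑ i, w i * x i) (fun x => ∑ i, v i * x i) (by fun_prop) (by fun_prop) t s
  rw [one_real n w hw, one_real n v hv] at hcov
  have pt := pdf_pos t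
  have ps := pdf_pos s
  have hT : 0 < (1 + |t|) * (1 + |s|) := by positivity
  have hdiff : ∑ i, (w i - v i) ^ 2 = 2 - 2 * ∑ i, w i * v i := by
    have : ∑ i, (w i - v i) ^ 2 = ∑ i, w i ^ 2 + ∑ i, v i ^ 2 - 2 * ∑ i, w i * v i := by
      rw [Finset.mul_sum, ← Finset.sum_add_distrib, ← Finset.sum_sub_distrib]
      exact Finset.sum_congr rfl fun i _ => by ring
    rw [this, hw, hv]; ring
  have hnn : 0 ≤ ∑ i, (w i - v i) ^ 2 := Finset.sum_nonneg fun i _ => sq_nonneg _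
  have hle : ∑ i, w i * v i ≤ 1 := by linarith
  rw [ge_iff_le, gaussCov, _root_.stdGaussian, hcov]
  rcases hle.lt_or_eq with hlt | heq
  · rw [two_real n w v hw hv (by nlinarith)]
    have hg := jointG_gap t s _ hρ hlt
    set ρ := ∑ i, w i * v i
    have : Real.exp (-1) * Real.exp (-1) * ρ * stdNormalPDF t * stdNormalPDF s /
        ((1 + |t|) * (1 + |s|)) ≤ 4 * (Real.exp (-1) * (stdNormalPDF t * stdNormalPDF s) *
          (ρ / (2 * ((1 + |t|) * (1 + |s|))))) := by
      have e : 4 * (Real.exp (-1) * (stdNormalPDF t * stdNormalPDF s) *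
          (ρ / (2 * ((1 + |t|) * (1 + |s|))))) =
          2 * (Real.exp (-1) * ρ * stdNormalPDF t * stdNormalPDF s) / ((1 + |t|) * (1 + |s|)) := by
        field_simp; ring
      rw [e]
      refine div_le_div_of_nonneg_right ?_ hT.le
      have : 0 < Real.exp (-1) * ρ * stdNormalPDF t * stdNormalPDF s := by positivity
      nlinarith
    linarith
  · have hwv : w = v := by
      rw [heq] at hdiff
      have h0 := (Finset.sum_eq_zero_iff_of_nonneg (fun i _ => sq_nonneg (w i - v i))).1
        (hdiff.trans (by norm_num))
      ext i
      have := pow_eq_zero_iff (two_ne_zero) |>.1 (h0 i (Finset.mem_univ i))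
      linarith
    have hset : {x : Fin n → ℝ | t < ∑ i, w i * x i ∧ s < ∑ i, v i * x i} =
        {x | max t s < ∑ i, w i * x i} := by
      rw [← hwv]; ext x; simp
    rw [hset, one_real n w hw, heq]
    have hprod : tailQ (max t s) - tailQ t * tailQ s = tailQ (max t s) * tailQ (-(min t s)) := by
      rw [tailQ_neg]
      rcases le_total t s with h | h
      · rw [max_eq_right h, min_eq_left h]; ring
      · rw [max_eq_left h, min_eq_right h]; ring
    rw [hprod]
    have l1 := tailQ_lower (max t s)
    have l2 := tailQ_lower (-(min t s))
    have hneg : stdNormalPDF (-(min t s)) = stdNormalPDF (min t s) := by simp [stdNormalPDF]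
    rw [abs_neg, hneg] at l2
    have p1 := pdf_pos (max t s)
    have p2 := pdf_pos (min t s)
    have l3 := mul_le_mul l1 l2 (by positivity) (tailQ_nonneg _)
    have e : Real.exp (-1) * stdNormalPDF (max t s) / (1 + |max t s|) *
        (Real.exp (-1) * stdNormalPDF (min t s) / (1 + |min t s|)) =
        Real.exp (-1) * Real.exp (-1) * 1 * stdNormalPDF t * stdNormalPDF s /
          ((1 + |t|) * (1 + |s|)) := by
      rcases le_total t s with h | h
      · rw [max_eq_right h, min_eq_left h]; field_simp
      · rw [max_eq_left h, min_eq_right h]; field_simp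
    rw [e] at l3
    have := mul_nonneg (tailQ_nonneg (max t s)) (tailQ_nonneg (-(min t s)))
    linarith
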